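/- Let f : 2^M → ℝ be a submodular set function with multilinear extension F, let x ∈ [0,1]^M, and let j ≠ k be two elements of M. For a,b ∈ {0,1}, let x^{(a,b)} denote the vector obtained from x by setting coordinate j to a and coordinate k to b. Then F(x^{(1,1)}) − F(x^{(1,0)}) − F(x^{(0,1)}) + F(x^{(0,0)}) ≤ 0. -/

import Mathlib

open Finset

/-- A submodular set function. -/
def IsSubmodularR {M : Type*} [DecidableEq M] (f : Finset M → ℝ) : Prop :=
  ∀ A B : Finset M, f (A ∪ B) + f (A ∩ B) ≤ f A + f B

/-- A monotone set function. -/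
def IsMonotoneR {M : Type*} (f : Finset M → ℝ) : Prop :=
  ∀ A B : Finset M, A ⊆ B → f A ≤ f B

/-- The multilinear extension of a set function. -/
noncomputable def mlExtR {M : Type*} [Fintype M] [DecidableEq M]
    (f : Finset M → ℝ) (y : M → ℝ) : ℝ :=
  ∑ S : Finset M, f S * ((∏ j ∈ S, y j) * ∏ j ∈ Sᶜ, (1 - y j))

/-- The product weight away from `k`. -/
noncomputable def restW {M : Type*} [Fintype M] [DecidableEq M]
    (k : M) (y : M → ℝ) (T : Finset M) : ℝ :=
  ∏ i ∈ univ.erase k, if i ∈ T then y i else 1 - y i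

lemma weight_eq {M : Type*} [Fintype M] [DecidableEq M] (y : M → ℝ) (S : Finset M) :
    (∏ j ∈ S, y j) * ∏ j ∈ Sᶜ, (1 - y j) = ∏ i, if i ∈ S then y i else 1 - y i := by
  rw [← Finset.prod_mul_prod_compl S (fun i => if i ∈ S then y i else 1 - y i)]
  congr 1
  · exact Finset.prod_congr rfl fun i hi => by simp [hi]
  · exact Finset.prod_congr rfl fun i hi => by simp [Finset.mem_compl.1 hi]

lemma mlExtR_split {M : Type*} [Fintype M] [DecidableEq M]
    (k : M) (f : Finset M → ℝ) (y : M → ℝ) :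
    mlExtR f y = ∑ T ∈ (univ.erase k).powerset,
      restW k y T * ((1 - y k) * f T + y k * f (insert k T)) := by
  unfold mlExtR
  simp_rw [weight_eq]
  have hu : (univ : Finset (Finset M)) = (insert k (univ.erase k)).powerset := by
    rw [Finset.insert_erase (mem_univ k), Finset.powerset_univ]
  rw [hu, Finset.sum_powerset_insert (Finset.notMem_erase k univ), ← Finset.sum_add_distrib]
  refine Finset.sum_congr rfl fun T hT => ?_
  have hkT : k ∉ T := fun h => by simpa using Finset.mem_powerset.1 hT h
  rw [← Finset.mul_prod_erase univ _ (mem_univ k), ← Finset.mul_prod_erase univ _ (mem_univ k)]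
  have h2 : (∏ i ∈ univ.erase k, if i ∈ insert k T then y i else 1 - y i) = restW k y T := by
    refine Finset.prod_congr rfl fun i hi => ?_
    simp [Finset.ne_of_mem_erase hi]
  rw [h2]
  change f T * (_ * restW k y T) + _ = _
  simp only [hkT, Finset.mem_insert_self, if_true, if_false]
  ring

lemma restW_update {M : Type*} [Fintype M] [DecidableEq M]
    (k : M) (y : M → ℝ) (b : ℝ) (T : Finset M) :
    restW k (Function.update y k b) T = restW k y T := by
  refine Finset.prod_congr rfl fun i hi => ?_
  simp [Function.update_of_ne (Finset.ne_of_mem_erase hi)]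

lemma mlExtR_update_one {M : Type*} [Fintype M] [DecidableEq M]
    (k : M) (f : Finset M → ℝ) (y : M → ℝ) :
    mlExtR f (Function.update y k 1) = mlExtR (fun S => f (insert k S)) y := by
  rw [mlExtR_split k, mlExtR_split k]
  refine Finset.sum_congr rfl fun T _ => ?_
  rw [restW_update]
  simp only [Function.update_self, Finset.insert_idem]
  ring

lemma mlExtR_update_zero {M : Type*} [Fintype M] [DecidableEq M]
    (k : M) (f : Finset M → ℝ) (y : M → ℝ) :
    mlExtR f (Function.update y k 0) = mlExtR (fun S => f (S.erase k)) y := by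
  rw [mlExtR_split k, mlExtR_split k]
  refine Finset.sum_congr rfl fun T hT => ?_
  have hkT : k ∉ T := fun h => by simpa using Finset.mem_powerset.1 hT h
  rw [restW_update]
  simp only [Function.update_self, Finset.erase_insert hkT, Finset.erase_eq_of_notMem hkT]
  ring

/-- second-order condition of the multilinear extension of a submodular
function in two distinct coordinates. -/
theorem stmt6 {M : Type*} [Fintype M] [DecidableEq M]
    (f : Finset M → ℝ) (hf : IsSubmodularR f)
    (x : M → ℝ) (hx : ∀ l, 0 ≤ x l ∧ x l ≤ 1)
    (j k : M) (hjk : j ≠ k) :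
    mlExtR f (Function.update (Function.update x j 1) k 1)
      - mlExtR f (Function.update (Function.update x j 1) k 0)
      - mlExtR f (Function.update (Function.update x j 0) k 1)
      + mlExtR f (Function.update (Function.update x j 0) k 0) ≤ 0 := by
  simp only [mlExtR_update_one, mlExtR_update_zero]
  unfold mlExtR
  rw [← Finset.sum_sub_distrib, ← Finset.sum_sub_distrib, ← Finset.sum_add_distrib]
  refine Finset.sum_nonpos fun S _ => ?_
  have hw : 0 ≤ (∏ i ∈ S, x i) * ∏ i ∈ Sᶜ, (1 - x i) :=
    mul_nonneg (Finset.prod_nonneg fun i _ => (hx i).1)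
      (Finset.prod_nonneg fun i _ => sub_nonneg.2 (hx i).2)
  have h := hf ((insert j S).erase k) (insert k (S.erase j))
  have e1 : (insert j S).erase k ∪ insert k (S.erase j) = insert k (insert j S) := by
    ext i; simp only [mem_union, mem_erase, mem_insert]; grind
  have e2 : (insert j S).erase k ∩ insert k (S.erase j) = (S.erase j).erase k := by
    ext i; simp only [mem_inter, mem_erase, mem_insert]; grind
  rw [e1, e2] at h
  nlinarith [mul_nonneg hw (sub_nonneg.2 h)]
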